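/- There is a universal constant C > 0 such that for every ε > 0, β ∈ (0,1), integers d, T ≥ 1, and every threshold vector κ ∈ ℝ^d, there exists an ε-differentially private (event level) continual-observation mechanism M with input universe {0,1}^d, output space {Yes,No}^d and stream length T such that for every input stream x, with M(x)-probability at least 1 − β, the output sequence (a^1,…,a^T) satisfies, for all t ≤ T and i ≤ d: if h^t(x)_i ≥ κ_i + α^t then a^t_i = Yes, and if h^t(x)_i ≤ κ_i − α^t then a^t_i = No, where α^t = C · ε^{-1} · ( d·log²(d/β) + log(t/β) ) (the d-dimensional AboveThreshold problem). -/

import Mathlib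

open MeasureTheory

/-- Base-2 logarithm where the argument is clamped below by 2. -/
noncomputable def log2c (z : ℝ) : ℝ := Real.logb 2 (max z 2)

/-- The histogram of a stream of rows from `{0,1}^d` at time step `t`:
the `i`-th column sum of the first `t+1` rows (time steps are 0-indexed). -/
def hist {d T : ℕ} (x : Fin T → Fin d → Bool) (t : Fin T) (i : Fin d) : ℕ :=
  ∑ s : Fin T, if s ≤ t ∧ x s i then 1 else 0

/-- Two streams differ in at most one time step (event-level neighboring). -/
def EventNeighboring {X : Type*} {T : ℕ} (x y : Fin T → X) : Prop :=
  ∃ t₀ : Fin T, ∀ s : Fin T, s ≠ t₀ → x s = y s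

/-- A continual-observation mechanism: a measurable assignment of output
distributions to input streams whose outputs up to time `t` depend only on the
first `t` inputs. -/
def IsCOMech {X O : Type*} [MeasurableSpace X] [MeasurableSpace O] {T : ℕ}
    (M : (Fin T → X) → Measure (Fin T → O)) : Prop :=
  Measurable M ∧ (∀ x, IsProbabilityMeasure (M x)) ∧
    ∀ (t : Fin T) (x y : Fin T → X), (∀ s, s ≤ t → x s = y s) →
      (M x).map (fun a (s : {s : Fin T // s ≤ t}) => a s.1) =
      (M y).map (fun a (s : {s : Fin T // s ≤ t}) => a s.1)

/-- `ε`-differential privacy (event level) for a continual-observation mechanism. -/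
def IsEventDP {X O : Type*} [MeasurableSpace X] [MeasurableSpace O] {T : ℕ} (ε : ℝ)
    (M : (Fin T → X) → Measure (Fin T → O)) : Prop :=
  ∀ x y, EventNeighboring x y → ∀ S : Set (Fin T → O), MeasurableSet S →
    M x S ≤ ENNReal.ofReal (Real.exp ε) * M y S


namespace DAT
open scoped NNReal ENNReal

abbrev Hst (d : ℕ) := List (Option (Fin d))

noncomputable def Lam {d : ℕ} (ρ : Hst d → Fin d → ℝ≥0) : Hst d → ℝ≥0
  | [] => 0
  | none :: l => Lam ρ l + ∑ i, ρ l i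
  | some _ :: _ => 0

noncomputable def q {d : ℕ} (ρ : Hst d → Fin d → ℝ≥0) (l : Hst d) : Option (Fin d) → ℝ≥0
  | none => (1 + Lam ρ l) / (1 + Lam ρ l + ∑ i, ρ l i)
  | some i => ρ l i / (1 + Lam ρ l + ∑ i, ρ l i)

lemma q_sum' {d : ℕ} (ρ : Hst d → Fin d → ℝ≥0) (l : Hst d) : ∑ o, q ρ l o = 1 := by
  rw [Fintype.sum_option]
  simp only [q]
  rw [← Finset.sum_div, ← add_div]
  exact div_self (by positivity)

lemma q_sum {d : ℕ} (ρ : Hst d → Fin d → ℝ≥0) (l : Hst d) :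
    ∑ o, (q ρ l o : ℝ≥0∞) = 1 := by
  exact_mod_cast q_sum' ρ l

noncomputable def qP {d : ℕ} (ρ : Hst d → Fin d → ℝ≥0) (l : Hst d) : PMF (Option (Fin d)) :=
  PMF.ofFintype (fun o => (q ρ l o : ℝ≥0∞)) (q_sum ρ l)

noncomputable def mu {d : ℕ} (ρ : Hst d → Fin d → ℝ≥0) : ℕ → Hst d → PMF (Hst d)
  | 0, l => PMF.pure l
  | k+1, l => (qP ρ l).bind fun o => mu ρ k (o :: l)

noncomputable def W {d : ℕ} (ρ : Hst d → Fin d → ℝ≥0) : Hst d → ℝ≥0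
  | [] => 1
  | o :: l => W ρ l * q ρ l o

lemma mu_succ {d : ℕ} (ρ : Hst d → Fin d → ℝ≥0) (k : ℕ) (l : Hst d) :
    mu ρ (k+1) l = (mu ρ k l).bind fun l' => (qP ρ l').map (· :: l') := by
  induction k generalizing l with
  | zero => simp [mu, PMF.map, Function.comp_def]
  | succ k ih =>
    conv_lhs => rw [mu]
    simp only [ih]
    rw [← PMF.bind_bind]
    conv_rhs => rw [← ih, mu]

lemma mu_apply {d : ℕ} (ρ : Hst d → Fin d → ℝ≥0) (k : ℕ) (l : Hst d) :
    mu ρ k [] l = if l.length = k then (W ρ l : ℝ≥0∞) else 0 := by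
  induction k generalizing l with
  | zero => cases l <;> simp [mu, W]
  | succ k ih =>
    rw [mu_succ, PMF.bind_apply]
    cases l with
    | nil => simp [PMF.map_apply]
    | cons o l =>
      rw [tsum_eq_single l]
      · rw [ih, PMF.map_apply, tsum_eq_single o]
        · by_cases h : l.length = k <;> simp [h, W, qP]
        · intro o' ho
          simp [ho.symm]
      · intro l' hl
        simp [PMF.map_apply, hl.symm]

lemma mu_tail {d : ℕ} (ρ : Hst d → Fin d → ℝ≥0) (k m : ℕ) :
    (mu ρ (k + m) []).map (List.drop m) = mu ρ k [] := by
  induction m with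
  | zero => simp; exact PMF.map_id _
  | succ m ih =>
    rw [← add_assoc, mu_succ, PMF.map_bind]
    simp only [PMF.map_comp]
    have : ∀ l' : Hst d, (List.drop (m+1) ∘ fun o : Option (Fin d) => o :: l') = Function.const _ (List.drop m l') := by
      intro l'; funext o; simp
    simp only [this, PMF.map_const]
    exact ih

lemma W_congr {d : ℕ} (ρ ρ' : Hst d → Fin d → ℝ≥0) (k : ℕ)
    (h : ∀ l, l.length < k → ρ l = ρ' l) (l : Hst d) (hl : l.length ≤ k) :
    W ρ l = W ρ' l ∧ Lam ρ l = Lam ρ' l := by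
  induction l with
  | nil => simp [W, Lam]
  | cons o l ih =>
    simp only [List.length_cons] at hl
    obtain ⟨h1, h2⟩ := ih (by omega)
    have h3 := h l (by omega)
    constructor
    · rw [W, W, h1]
      cases o <;> simp [q, h2, h3]
    · cases o <;> simp [Lam, h2, h3]

lemma mu_congr {d : ℕ} (ρ ρ' : Hst d → Fin d → ℝ≥0) (k : ℕ)
    (h : ∀ l, l.length < k → ρ l = ρ' l) : mu ρ k [] = mu ρ' k [] := by
  ext l
  rw [mu_apply, mu_apply]
  split_ifs with hl
  · rw [(W_congr ρ ρ' k h l hl.le).1]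
  · rfl

abbrev sel {d : ℕ} (l : Hst d) : List (Fin d) := l.reduceOption

lemma W_priv {d : ℕ} (ρ ρ' : Hst d → Fin d → ℝ≥0) (r : ℝ≥0) (hr : 1 ≤ r) (j0 : ℕ) (l : Hst d)
    (h : ∀ l', l' <:+ l → (l'.reduceOption.length ≠ j0 → ρ l' = ρ' l') ∧
      ∀ i, ρ l' i ≤ r * ρ' l' i ∧ ρ' l' i ≤ r * ρ l' i) :
    (l.reduceOption.length < j0 → W ρ l = W ρ' l ∧ Lam ρ l = Lam ρ' l) ∧
    (l.reduceOption.length = j0 → W ρ l * (1 + Lam ρ l) = W ρ' l * (1 + Lam ρ' l) ∧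
      Lam ρ l ≤ r * Lam ρ' l ∧ Lam ρ' l ≤ r * Lam ρ l) ∧
    (j0 < l.reduceOption.length → W ρ l ≤ r ^ 3 * W ρ' l ∧ Lam ρ l = Lam ρ' l) := by
  induction l with
  | nil => 
    refine ⟨fun _ => by simp [W, Lam], fun _ => by simp [W, Lam], fun h => ?_⟩
    simp at h
  | cons o l ih =>
    obtain ⟨i1, i2, i3⟩ := ih (fun l' hl' => h l' (hl'.trans (List.suffix_cons o l)))
    obtain ⟨g1, g2⟩ := h l (List.suffix_cons o l)
    have hs1 : ∑ i, ρ l i ≤ r * ∑ i, ρ' l i := by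
      rw [Finset.mul_sum]; exact Finset.sum_le_sum fun i _ => (g2 i).1
    have hs2 : ∑ i, ρ' l i ≤ r * ∑ i, ρ l i := by
      rw [Finset.mul_sum]; exact Finset.sum_le_sum fun i _ => (g2 i).2
    cases o with
    | none =>
      rw [List.reduceOption_cons_of_none]
      refine ⟨fun hj => ?_, fun hj => ?_, fun hj => ?_⟩
      · obtain ⟨a, b⟩ := i1 hj
        simp [W, Lam, q, a, b, g1 hj.ne]
      · obtain ⟨a, b, c⟩ := i2 hj
        refine ⟨?_, ?_, ?_⟩
        · simp only [W, Lam, q]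
          rw [← add_assoc, ← add_assoc, mul_assoc, mul_assoc, div_mul_cancel₀ _ (by positivity),
            div_mul_cancel₀ _ (by positivity), a]
        · simp only [Lam]
          rw [mul_add]; exact add_le_add b hs1
        · simp only [Lam]
          rw [mul_add]; exact add_le_add c hs2
      · obtain ⟨a, b⟩ := i3 hj
        have g := g1 hj.ne'
        refine ⟨?_, by simp [Lam, b, g]⟩
        simp only [W, q, b, g]
        rw [← mul_assoc]
        gcongr
    | some i =>
      rw [List.reduceOption_cons_of_some, List.length_cons]
      refine ⟨fun hj => ?_, fun hj => ?_, fun hj => ?_⟩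
      · obtain ⟨a, b⟩ := i1 (by omega)
        have g := g1 (by omega)
        simp [W, Lam, q, a, b, g]
      · obtain ⟨a, b⟩ := i1 (by omega)
        have g := g1 (by omega)
        simp [W, Lam, q, a, b, g]
      · refine ⟨?_, by simp [Lam]⟩
        by_cases hj' : l.reduceOption.length = j0
        · obtain ⟨a, b, c⟩ := i2 hj'
          have e1 : W ρ l ≤ r * W ρ' l := by
            have : W ρ l * (1 + Lam ρ l) ≤ (r * W ρ' l) * (1 + Lam ρ l) := by
              rw [a, mul_comm r, mul_assoc]
              gcongr
              rw [mul_add, mul_one]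
              exact add_le_add hr c
            exact le_of_mul_le_mul_right this (by positivity)
          have e2 : q ρ l (some i) ≤ r ^ 2 * q ρ' l (some i) := by
            simp only [q]
            rw [← mul_div_assoc, div_le_div_iff₀ (by positivity) (by positivity)]
            calc ρ l i * (1 + Lam ρ' l + ∑ i, ρ' l i) 
                ≤ (r * ρ' l i) * (r * (1 + Lam ρ l + ∑ i, ρ l i)) := by
                  gcongr
                  · exact (g2 i).1
                  · rw [mul_add, mul_add, mul_one]
                    gcongr
              _ = _ := by ring
          simp only [W]
          calc _ ≤ (r * W ρ' l) * (r ^ 2 * q ρ' l (some i)) := mul_le_mul' e1 e2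
            _ = _ := by ring
        · obtain ⟨a, b⟩ := i3 (by omega)
          have g := g1 hj'
          simp only [W, q, b, g]
          rw [← mul_assoc]
          gcongr

lemma W_priv' {d : ℕ} (ρ ρ' : Hst d → Fin d → ℝ≥0) (r : ℝ≥0) (hr : 1 ≤ r) (j0 : ℕ) (l : Hst d)
    (h : ∀ l', l' <:+ l → (l'.reduceOption.length ≠ j0 → ρ l' = ρ' l') ∧
      ∀ i, ρ l' i ≤ r * ρ' l' i ∧ ρ' l' i ≤ r * ρ l' i) :
    W ρ l ≤ r ^ 3 * W ρ' l := by
  obtain ⟨i1, i2, i3⟩ := W_priv ρ ρ' r hr j0 l h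
  have hr3 : 1 ≤ r ^ 3 := one_le_pow₀ hr
  rcases lt_trichotomy l.reduceOption.length j0 with hj | hj | hj
  · rw [(i1 hj).1]
    exact le_mul_of_one_le_left (by positivity) hr3
  · obtain ⟨a, b, c⟩ := i2 hj
    have e1 : W ρ l ≤ r * W ρ' l := by
      have : W ρ l * (1 + Lam ρ l) ≤ (r * W ρ' l) * (1 + Lam ρ l) := by
        rw [a, mul_comm r, mul_assoc]
        gcongr
        rw [mul_add, mul_one]
        exact add_le_add hr c
      exact le_of_mul_le_mul_right this (by positivity)
    refine e1.trans ?_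
    gcongr
    exact le_self_pow₀ hr (by norm_num)
  · exact (i3 hj).1

def Bad {d : ℕ} (ρ : Hst d → Fin d → ℝ≥0) (K : ℝ≥0) (sb : Hst d → Fin d → Prop) : Hst d → Prop
  | [] => False
  | none :: l => Bad ρ K sb l ∨ K ≤ Lam ρ (none :: l)
  | some i :: l => Bad ρ K sb l ∨ sb l i

noncomputable def Fp {d : ℕ} (ρ : Hst d → Fin d → ℝ≥0) (K c : ℝ≥0) (l : Hst d) : ℝ≥0 :=
  (Lam ρ l + ((d - l.reduceOption.length : ℕ) : ℝ≥0)) / K + c * d / (l.length + 1)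

lemma mart {d : ℕ} (ρ : Hst d → Fin d → ℝ≥0) (l : Hst d)
    (hρ : ∀ i, ρ l i ≠ 0 → l.reduceOption.length < d) :
    ∑ o, q ρ l o * (Lam ρ (o :: l) + ((d - (o :: l).reduceOption.length : ℕ) : ℝ≥0))
      = Lam ρ l + ((d - l.reduceOption.length : ℕ) : ℝ≥0) := by
  rw [Fintype.sum_option]
  simp only [q, Lam, List.reduceOption_cons_of_none, List.reduceOption_cons_of_some, zero_add,
    List.length_cons]
  by_cases hz : ∀ i, ρ l i = 0
  · simp [hz]
  · push Not at hz
    obtain ⟨i, hi⟩ := hz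
    have hd := hρ i hi
    obtain ⟨D, hD⟩ : ∃ D, d - l.reduceOption.length = D + 1 := ⟨d - l.reduceOption.length - 1, by omega⟩
    have hD' : d - (l.reduceOption.length + 1) = D := by omega
    rw [hD, hD', ← Finset.sum_mul, ← Finset.sum_div]
    have : 1 + Lam ρ l + ∑ i, ρ l i ≠ 0 := by positivity
    push_cast
    field_simp
    ring

lemma step_bound {d : ℕ} (ρ : Hst d → Fin d → ℝ≥0) (K c : ℝ≥0) (hK : 0 < K)
    (sb : Hst d → Fin d → Prop) (l : Hst d)
    (hρ : ∀ i, ρ l i ≠ 0 → l.reduceOption.length < d)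
    (hsb : ∀ i, sb l i → ρ l i ≤ c / ((l.length + 1) * (l.length + 2))) 
    (hl : ¬ Bad ρ K sb l) [DecidablePred (Bad ρ K sb)] :
    ∑ o, q ρ l o * (if Bad ρ K sb (o :: l) then 1 else Fp ρ K c (o :: l)) ≤ Fp ρ K c l := by
  have key : ∀ o, q ρ l o * (if Bad ρ K sb (o :: l) then 1 else Fp ρ K c (o :: l)) ≤
      q ρ l o * Fp ρ K c (o :: l) + (if o.isSome then c / ((l.length + 1) * (l.length + 2)) else 0) := by
    intro o
    split_ifs with h1 h2 h2
    · obtain ⟨i, rfl⟩ := Option.isSome_iff_exists.1 h2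
      have h3 : sb l i := by simpa [Bad, hl] using h1
      refine le_add_of_nonneg_of_le (by positivity) ?_
      rw [mul_one]
      refine le_trans ?_ (hsb i h3)
      simp only [q]
      refine div_le_self (by positivity) ?_
      rw [add_assoc]
      exact le_add_of_nonneg_right (by positivity)
    · have h3 : o = none := by simpa using h2
      subst h3
      have h4 : K ≤ Lam ρ (none :: l) := by simpa [Bad, hl] using h1
      rw [add_zero]
      gcongr
      rw [Fp]
      refine le_add_of_le_of_nonneg ?_ (by positivity)
      rw [le_div_iff₀ hK, one_mul]
      exact le_add_of_le_of_nonneg h4 (by positivity)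
    · exact le_add_of_nonneg_right (by positivity)
    · exact le_add_of_nonneg_right (by positivity)
  refine (Finset.sum_le_sum fun o _ => key o).trans ?_
  rw [Finset.sum_add_distrib]
  have e1 : ∑ o, q ρ l o * Fp ρ K c (o :: l) = 
      (Lam ρ l + ((d - l.reduceOption.length : ℕ) : ℝ≥0)) / K + c * d / (l.length + 2) := by
    rw [← mart ρ l hρ, Finset.sum_div]
    have : c * d / ((l.length : ℝ≥0) + 2) = ∑ o, q ρ l o * (c * d / ((l.length : ℝ≥0) + 2)) := by
      rw [← Finset.sum_mul, q_sum', one_mul]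
    rw [this, ← Finset.sum_add_distrib]
    refine Finset.sum_congr rfl fun o _ => ?_
    rw [Fp, mul_add, ← mul_div_assoc, List.length_cons]
    push_cast
    rw [add_assoc (l.length : ℝ≥0), one_add_one_eq_two]
  rw [e1, Fp, Fintype.sum_option]
  simp only [Option.isSome_none, Option.isSome_some, if_true, Finset.sum_const, Finset.card_univ,
    Fintype.card_fin, nsmul_eq_mul, Bool.false_eq_true, if_false, zero_add]
  rw [add_assoc]
  gcongr
  apply le_of_eq
  have : (l.length : ℝ≥0) + 1 ≠ 0 := by positivity
  have : (l.length : ℝ≥0) + 2 ≠ 0 := by positivity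
  field_simp
  ring

open Classical in
lemma bad_bound {d : ℕ} (ρ : Hst d → Fin d → ℝ≥0) (K c : ℝ≥0) (hK : 0 < K)
    (sb : Hst d → Fin d → Prop)
    (hρ : ∀ l i, ρ l i ≠ 0 → l.reduceOption.length < d)
    (hsb : ∀ l i, sb l i → ρ l i ≤ c / ((l.length + 1) * (l.length + 2))) (k : ℕ) (l : Hst d) :
    (mu ρ k l).toOuterMeasure {l | Bad ρ K sb l} ≤ 
      ((if Bad ρ K sb l then 1 else Fp ρ K c l : ℝ≥0) : ℝ≥0∞) := by
  induction k generalizing l with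
  | zero =>
    rw [mu, PMF.toOuterMeasure_pure_apply]
    simp only [Set.mem_ofPred_eq]
    split_ifs <;> simp
  | succ k ih =>
    by_cases hl : Bad ρ K sb l
    · simp only [hl, if_true]
      calc _ ≤ (mu ρ (k+1) l).toOuterMeasure Set.univ := measure_mono (Set.subset_univ _)
        _ ≤ _ := by
          rw [PMF.toOuterMeasure_apply]; simp
    · simp only [hl, if_false]
      rw [mu, PMF.toOuterMeasure_bind_apply, tsum_fintype]
      refine le_trans ?_ (ENNReal.coe_le_coe.2 (step_bound ρ K c hK sb l (hρ l) (hsb l) hl))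
      push_cast
      refine Finset.sum_le_sum fun o _ => ?_
      have := ih (o :: l)
      simp only [qP, PMF.ofFintype_apply]
      gcongr

end DAT
namespace DAT
open scoped NNReal ENNReal

lemma hasSum_geomZ (r : ℝ) (h0 : 0 ≤ r) (h1 : r < 1) :
    HasSum (fun z : ℤ => r ^ z.natAbs) ((1 + r) / (1 - r)) := by
  have a := hasSum_geometric_of_lt_one h0 h1
  have e : (1 + r) / (1 - r) = (1 - r)⁻¹ + (1 - r)⁻¹ * r := by
    have : 1 - r ≠ 0 := by linarith
    field_simp
  rw [e]
  refine HasSum.of_nat_of_neg_add_one (by simpa using a) ?_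
  have b := a.mul_right r
  refine b.congr_fun ?_ |> id
  intro n
  have : (-((n : ℤ) + 1)).natAbs = n + 1 := by omega
  rw [this, pow_succ]

noncomputable def gw (r : ℝ) (z : ℤ) : ℝ := (1 - r) / (1 + r) * r ^ z.natAbs

lemma gw_nonneg {r : ℝ} (h0 : 0 ≤ r) (h1 : r < 1) (z : ℤ) : 0 ≤ gw r z := by
  unfold gw
  have : 0 < 1 - r := by linarith
  positivity

lemma gw_sum {r : ℝ} (h0 : 0 ≤ r) (h1 : r < 1) :
    HasSum (fun z => ENNReal.ofReal (gw r z)) 1 := by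
  have h := (hasSum_geomZ r h0 h1).mul_left ((1 - r) / (1 + r))
  have e : (1 - r) / (1 + r) * ((1 + r) / (1 - r)) = 1 := by
    have : 1 - r ≠ 0 := by linarith
    have : 1 + r ≠ 0 := by linarith
    field_simp
  rw [e] at h
  have h2 := ENNReal.ofReal_tsum_of_nonneg (fun z => gw_nonneg h0 h1 z) h.summable
  rw [show ∑' z, gw r z = 1 from h.tsum_eq, ENNReal.ofReal_one] at h2
  rw [h2]
  exact ENNReal.summable.hasSum

noncomputable def gP (r : ℝ) (h0 : 0 ≤ r) (h1 : r < 1) : PMF ℤ :=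
  ⟨fun z => ENNReal.ofReal (gw r z), gw_sum h0 h1⟩

lemma gP_apply (r : ℝ) (h0 : 0 ≤ r) (h1 : r < 1) (z : ℤ) :
    gP r h0 h1 z = ENNReal.ofReal (gw r z) := rfl

lemma pi_mgf (ι : Type) [Fintype ι] (g : PMF ℤ) (f : ℤ → ℝ≥0∞) (S : Finset ι) :
    ∫⁻ N, ∏ n ∈ S, f (N n) ∂(Measure.pi fun _ : ι => g.toMeasure) =
      ∏ n ∈ S, ∫⁻ z, f z ∂g.toMeasure := by
  have hf : Measurable f := Measurable.of_discrete
  have hi := ProbabilityTheory.iIndepFun_pi (ι := ι) (μ := fun _ : ι => g.toMeasure)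
      (X := fun _ z => f z) (fun i => hf.aemeasurable)
  rw [ProbabilityTheory.lintegral_prod_eq_prod_lintegral_of_indepFun S
      (fun (n : ι) (N : ι → ℤ) => f (N n)) hi (fun i => hf.comp (measurable_pi_apply i))]
  refine Finset.prod_congr rfl fun n _ => ?_
  exact (measurePreserving_eval (fun _ : ι => g.toMeasure) n).lintegral_comp hf

noncomputable def nP (ι : Type) [Fintype ι] (r : ℝ) (h0 : 0 ≤ r) (h1 : r < 1) : PMF (ι → ℤ) :=
  (Measure.pi (fun _ : ι => (gP r h0 h1).toMeasure)).toPMF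

lemma nP_apply (ι : Type) [Fintype ι] (r : ℝ) (h0 : 0 ≤ r) (h1 : r < 1) (N : ι → ℤ) :
    nP ι r h0 h1 N = ENNReal.ofReal (((1 - r) / (1 + r)) ^ Fintype.card ι * r ^ (∑ n, (N n).natAbs)) := by
  rw [nP, Measure.toPMF_apply, Measure.pi_singleton]
  simp only [PMF.toMeasure_apply_singleton _ _ (measurableSet_singleton _)]
  simp only [gP_apply]
  rw [← ENNReal.ofReal_prod_of_nonneg (fun n _ => gw_nonneg h0 h1 _)]
  simp only [gw]
  rw [Finset.prod_mul_distrib, Finset.prod_pow_eq_pow_sum, Finset.prod_const, Finset.card_univ]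

lemma nP_shift (ι : Type) [Fintype ι] (r : ℝ) (h0 : 0 < r) (h1 : r < 1) (N s : ι → ℤ) (m : ℕ)
    (hs : ∑ n, (s n).natAbs ≤ m) :
    nP ι r h0.le h1 N ≤ ENNReal.ofReal ((r ^ m)⁻¹) * nP ι r h0.le h1 (N - s) := by
  rw [nP_apply, nP_apply, ← ENNReal.ofReal_mul (by positivity)]
  apply ENNReal.ofReal_le_ofReal
  have h2 : ∑ n, ((N - s) n).natAbs ≤ ∑ n, (N n).natAbs + m := by
    refine le_trans ?_ (Nat.add_le_add_left hs _)
    rw [← Finset.sum_add_distrib]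
    refine Finset.sum_le_sum fun n _ => ?_
    simp only [Pi.sub_apply]; omega
  have h3 := pow_le_pow_of_le_one h0.le h1.le h2
  have h4 : (0:ℝ) ≤ ((1 - r) / (1 + r)) ^ Fintype.card ι := by
    have : 0 < 1 - r := by linarith
    positivity
  rw [mul_left_comm]
  refine mul_le_mul_of_nonneg_left ?_ h4
  rw [pow_add] at h3
  rw [← div_eq_inv_mul, le_div_iff₀ (by positivity)]
  exact h3

lemma gP_mgf (s : ℝ) (h0 : 0 < s) (h1 : s < 1) (hr0 : 0 ≤ s ^ 2) (hr : s ^ 2 < 1) :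
    ∫⁻ z, ENNReal.ofReal ((s ^ z.natAbs)⁻¹) ∂(gP (s^2) hr0 hr).toMeasure ≤ 2 := by
  rw [lintegral_countable']
  simp only [PMF.toMeasure_apply_singleton _ _ (measurableSet_singleton _)]
  simp only [gP_apply]
  have e : ∀ z : ℤ, ENNReal.ofReal ((s ^ z.natAbs)⁻¹) * ENNReal.ofReal (gw (s^2) z) =
      ENNReal.ofReal ((1 - s^2) / (1 + s^2) * s ^ z.natAbs) := by
    intro z
    rw [← ENNReal.ofReal_mul (by positivity)]
    congr 1
    rw [gw]
    have : s ^ z.natAbs ≠ 0 := by positivity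
    rw [← pow_mul, mul_comm 2, pow_mul]
    field_simp
  simp only [e]
  have h := (hasSum_geomZ s h0.le h1).mul_left ((1 - s^2) / (1 + s^2))
  rw [← ENNReal.ofReal_tsum_of_nonneg _ h.summable, h.tsum_eq]
  · rw [show (2:ℝ≥0∞) = ENNReal.ofReal 2 by simp]
    apply ENNReal.ofReal_le_ofReal
    have : 0 < 1 - s := by linarith
    rw [div_mul_div_comm, div_le_iff₀ (by positivity)]
    have : 0 ≤ (1 - s) * (1 - s)^2 := by positivity
    nlinarith
  · intro z
    have : 0 < 1 - s^2 := by linarith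
    positivity

lemma nP_tail (ι : Type) [Fintype ι] (s : ℝ) (h0 : 0 < s) (h1 : s < 1) (hr0 : 0 ≤ s ^ 2) (hr : s ^ 2 < 1) (S : Finset ι) (L : ℕ)
    (hS : S.card ≤ L) (δ : ℝ) (hδ : 0 < δ) :
    (nP ι (s^2) hr0 hr).toOuterMeasure
      {N | δ⁻¹ ≤ (s ^ (∑ n ∈ S, (N n).natAbs))⁻¹} ≤ ENNReal.ofReal (2 ^ L * δ) := by
  rw [← PMF.toMeasure_apply_eq_toOuterMeasure, nP, Measure.toPMF_toMeasure]
  set μ := Measure.pi (fun _ : ι => (gP (s^2) hr0 hr).toMeasure) with hμ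
  have hI : ∫⁻ N, ∏ n ∈ S, ENNReal.ofReal ((s ^ (N n).natAbs)⁻¹) ∂μ ≤ 2 ^ L := by
    rw [hμ, pi_mgf ι _ (fun z => ENNReal.ofReal ((s ^ z.natAbs)⁻¹))]
    calc _ ≤ ∏ n ∈ S, (2:ℝ≥0∞) := by
          refine Finset.prod_le_prod' fun n _ => ?_
          exact gP_mgf s h0 h1 hr0 hr
      _ ≤ _ := by
          rw [Finset.prod_const]
          exact pow_le_pow_right₀ (by norm_num) hS
  have hM := meas_ge_le_lintegral_div (μ := μ) (f := fun N => ∏ n ∈ S, ENNReal.ofReal ((s ^ (N n).natAbs)⁻¹))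
    (Measurable.of_discrete).aemeasurable (ε := ENNReal.ofReal δ⁻¹) (by simpa using hδ) (by simp)
  have e : {N : ι → ℤ | δ⁻¹ ≤ (s ^ (∑ n ∈ S, (N n).natAbs))⁻¹} ⊆
      {N | ENNReal.ofReal δ⁻¹ ≤ ∏ n ∈ S, ENNReal.ofReal ((s ^ (N n).natAbs)⁻¹)} := by
    intro N hN
    simp only [Set.mem_ofPred_eq] at hN ⊢
    rw [← ENNReal.ofReal_prod_of_nonneg (fun n _ => by positivity), Finset.prod_inv_distrib,
      Finset.prod_pow_eq_pow_sum]
    exact ENNReal.ofReal_le_ofReal hN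
  refine (measure_mono e).trans (hM.trans ?_)
  rw [ENNReal.ofReal_inv_of_pos hδ, div_eq_mul_inv, inv_inv, ENNReal.ofReal_mul (by positivity)]
  gcongr
  refine hI.trans (le_of_eq ?_)
  rw [ENNReal.ofReal_pow (by norm_num)]; simp

/-- tree -/
def zf {d L : ℕ} (N : Fin L × Fin d × Fin d → ℤ) (j : ℕ) (i : Fin d) : ℤ :=
  ∑ l : Fin L, ∑ k : Fin d, if (j / 2 ^ l.val) % 2 = 1 ∧ k.val + 1 = j / 2 ^ l.val then N (l, k, i) else 0

def shf {d L : ℕ} (j0 : ℕ) (v : Fin d → ℤ) (n : Fin L × Fin d × Fin d) : ℤ :=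
  if n.2.1.val = j0 / 2 ^ n.1.val then v n.2.2 else 0

lemma tree_count (L j j0 : ℕ) (hj : j < 2 ^ L) (hlt : j0 < j) :
    ∑ l : Fin L, (if (j / 2 ^ l.val) % 2 = 1 ∧ j0 / 2 ^ l.val + 1 = j / 2 ^ l.val then (1:ℤ) else 0) = 1 := by
  induction L generalizing j j0 with
  | zero => simp at hj; omega
  | succ L ih =>
    rw [Fin.sum_univ_succ]
    simp only [Fin.val_zero, pow_zero, Nat.div_one, Fin.val_succ]
    have e : ∀ m l : ℕ, m / 2 ^ (l + 1) = (m / 2) / 2 ^ l := by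
      intro m l; rw [pow_succ', Nat.div_div_eq_div_mul]
    simp only [e]
    by_cases h : j0 / 2 < j / 2
    · rw [ih (j / 2) (j0 / 2) (by rw [pow_succ] at hj; omega) h, if_neg (by omega), zero_add]
    · have h' : j0 / 2 = j / 2 := by omega
      rw [h', if_pos (by omega)]
      simp

lemma zf_shift {d L : ℕ} (hd : d ≤ 2 ^ L) (N : Fin L × Fin d × Fin d → ℤ) (j0 : ℕ) (v : Fin d → ℤ)
    (j : ℕ) (hj : j < d) (i : Fin d) :
    zf (N - shf j0 v) j i = zf N j i - if j0 < j then v i else 0 := by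
  have e : zf (N - shf j0 v) j i = zf N j i - zf (shf (L := L) j0 v) j i := by
    simp only [zf, Pi.sub_apply]
    rw [← Finset.sum_sub_distrib]
    refine Finset.sum_congr rfl fun l _ => ?_
    rw [← Finset.sum_sub_distrib]
    refine Finset.sum_congr rfl fun k _ => ?_
    split_ifs <;> simp
  rw [e]
  congr 1
  split_ifs with h
  · have := congrArg (· * v i) (tree_count L j j0 (by omega) h)
    simp only [one_mul] at this
    rw [← this, Finset.sum_mul, zf]
    refine Finset.sum_congr rfl fun l _ => ?_
    simp only [shf]
    have hk : j0 / 2 ^ l.val < d := lt_of_le_of_lt (Nat.div_le_self _ _) (by omega)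
    rw [Finset.sum_eq_single (⟨j0 / 2 ^ l.val, hk⟩ : Fin d)]
    · simp
    · intro k _ hk'
      have : k.val ≠ j0 / 2 ^ l.val := fun h => hk' (Fin.ext h)
      simp [this]
    · simp
  · simp only [zf, shf]
    refine Finset.sum_eq_zero fun l _ => Finset.sum_eq_zero fun k _ => ?_
    have : j / 2 ^ l.val ≤ j0 / 2 ^ l.val := Nat.div_le_div_right (by omega)
    split_ifs <;> first | rfl | omega

lemma shf_sum {d L : ℕ} (j0 : ℕ) (v : Fin d → ℤ) (hv : ∀ i, (v i).natAbs ≤ 1) :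
    ∑ n, (shf (L := L) j0 v n).natAbs ≤ L * d := by
  rw [Fintype.sum_prod_type]
  calc _ ≤ ∑ l : Fin L, d := by
        refine Finset.sum_le_sum fun l _ => ?_
        rw [Fintype.sum_prod_type_right]
        calc _ ≤ ∑ i : Fin d, 1 := by
              refine Finset.sum_le_sum fun i _ => ?_
              simp only [shf]
              by_cases hk : j0 / 2 ^ l.val < d
              · rw [Finset.sum_eq_single (⟨j0 / 2 ^ l.val, hk⟩ : Fin d)]
                · simpa using hv i
                · intro k _ hk'
                  have : k.val ≠ j0 / 2 ^ l.val := fun h => hk' (Fin.ext h)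
                  simp [this]
                · simp
              · rw [Finset.sum_eq_zero]
                · omega
                · intro k _
                  rw [if_neg (by omega)]; rfl
          _ = d := by simp
    _ = _ := by simp

def nodes {d : ℕ} (L : ℕ) (j : ℕ) (i : Fin d) : Finset (Fin L × Fin d × Fin d) :=
  Finset.univ.filter fun n => n.2.1.val + 1 = j / 2 ^ n.1.val ∧ n.2.2 = i

lemma nodes_card {d : ℕ} (L : ℕ) (j : ℕ) (i : Fin d) : (nodes L j i).card ≤ L := by
  calc _ ≤ (Finset.univ : Finset (Fin L)).card := by
        refine Finset.card_le_card_of_injOn (fun n => n.1) (by simp) ?_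
        rintro ⟨l, k, i1⟩ h1 ⟨l', k', i2⟩ h2 h
        simp [nodes] at h1 h2 h
        subst h
        have : k = k' := Fin.ext (by omega)
        simp [this, h1.2, h2.2]
    _ = L := by simp

lemma zf_le {d L : ℕ} (N : Fin L × Fin d × Fin d → ℤ) (j : ℕ) (i : Fin d) :
    (zf N j i).natAbs ≤ ∑ n ∈ nodes L j i, (N n).natAbs := by
  have e : ∑ n ∈ nodes L j i, (N n).natAbs = 
      ∑ l : Fin L, ∑ k : Fin d, if k.val + 1 = j / 2 ^ l.val then (N (l, k, i)).natAbs else 0 := by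
    rw [nodes, Finset.sum_filter, Fintype.sum_prod_type]
    refine Finset.sum_congr rfl fun l _ => ?_
    rw [Fintype.sum_prod_type]
    refine Finset.sum_congr rfl fun k _ => ?_
    rw [Finset.sum_eq_single i]
    · simp
    · intro b _ hb; simp [hb]
    · simp
  rw [e, zf]
  refine (Int.natAbs_sum_le _ _).trans (Finset.sum_le_sum fun l _ => ?_)
  refine (Int.natAbs_sum_le _ _).trans (Finset.sum_le_sum fun k _ => ?_)
  split_ifs with h1 h2 <;> simp_all
end DAT
namespace DAT
open scoped NNReal ENNReal

noncomputable def rate {d : ℕ} (e : ℝ) (κ : Fin d → ℝ) (z : ℕ → Fin d → ℤ) (H : ℕ → Fin d → ℕ)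
    (l : Hst d) (i : Fin d) : ℝ≥0 :=
  if i ∈ l.reduceOption ∨ d ≤ l.reduceOption.length then 0 else
    Real.toNNReal (Real.exp (e * (H l.length i - κ i + z l.reduceOption.length i)) /
      ((l.length + 1) * (l.length + 2)))

def Hx {d T : ℕ} (x : Fin T → Fin d → Bool) (u : ℕ) (i : Fin d) : ℕ :=
  ∑ s : Fin T, if s.val ≤ u / d ∧ x s i then 1 else 0

lemma Hx_eq {d T : ℕ} (x : Fin T → Fin d → Bool) (u : ℕ) (t : Fin T) (h : u / d = t.val) (i : Fin d) :
    Hx x u i = hist x t i := by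
  simp only [Hx, hist, h, Fin.le_def]

lemma Hx_le {d T : ℕ} (x : Fin T → Fin d → Bool) (u : ℕ) (t : Fin T) (h : u / d ≤ t.val) (i : Fin d) :
    Hx x u i ≤ hist x t i := by
  simp only [Hx, hist, Fin.le_def]
  refine Finset.sum_le_sum fun s _ => ?_
  by_cases hx : x s i
  · simp only [hx, and_true]
    split_ifs <;> omega
  · simp [hx]

lemma Hx_congr {d T : ℕ} (x y : Fin T → Fin d → Bool) (u : ℕ) (h : ∀ s : Fin T, s.val ≤ u / d → x s = y s) :
    Hx x u = Hx y u := by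
  funext i
  simp only [Hx]
  refine Finset.sum_congr rfl fun s _ => ?_
  by_cases hs : s.val ≤ u / d
  · rw [h s hs]
  · simp [hs]

def vv {d : ℕ} (a b : Fin d → Bool) (i : Fin d) : ℤ := (b i).toNat - (a i).toNat

lemma vv_le {d : ℕ} (a b : Fin d → Bool) (i : Fin d) : (vv a b i).natAbs ≤ 1 := by
  unfold vv
  cases a i <;> cases b i <;> simp

lemma Hx_nb {d T : ℕ} (x y : Fin T → Fin d → Bool) (t0 : Fin T) (h : ∀ s, s ≠ t0 → x s = y s)
    (u : ℕ) (i : Fin d) : 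
    (Hx y u i : ℤ) = Hx x u i + if t0.val ≤ u / d then vv (x t0) (y t0) i else 0 := by
  simp only [Hx]
  push_cast
  rw [← sub_eq_iff_eq_add', ← Finset.sum_sub_distrib, Finset.sum_eq_single t0]
  · by_cases hs : t0.val ≤ u / d
    · simp only [hs, true_and, if_true, vv]
      cases x t0 i <;> cases y t0 i <;> simp
    · simp [hs]
  · intro s _ hs
    rw [h s hs]; simp
  · simp

lemma suf_len {d : ℕ} {l l' : Hst d} (h : l' <:+ l) : l'.reduceOption.length ≤ l.reduceOption.length := by
  unfold List.reduceOption
  exact (h.sublist.filterMap id).length_le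

lemma rate_priv {d T L : ℕ} (hd0 : 0 < d) (hd : d ≤ 2 ^ L) (e : ℝ) (he : 0 < e) (κ : Fin d → ℝ)
    (x y : Fin T → Fin d → Bool) (t0 : Fin T) (h : ∀ s, s ≠ t0 → x s = y s)
    (N : Fin L × Fin d × Fin d → ℤ) (l : Hst d) :
    W (rate e κ (zf N) (Hx x)) l ≤ (Real.toNNReal (Real.exp e)) ^ 3 *
      W (rate e κ (zf (N - shf (l.drop (l.length - t0.val * d)).reduceOption.length
        (vv (x t0) (y t0)))) (Hx y)) l := by
  set j0 := (l.drop (l.length - t0.val * d)).reduceOption.length with hj0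
  have hr : 1 ≤ Real.toNNReal (Real.exp e) := by
    rw [Real.one_le_toNNReal]; exact Real.one_le_exp he.le
  refine W_priv' _ _ _ hr j0 l ?_
  intro l' hl'
  have hs := List.drop_suffix (l.length - t0.val * d) l
  have hlen := hl'.length_le
  have hle : t0.val * d ≤ l'.length → j0 ≤ l'.reduceOption.length := by
    intro hh
    refine suf_len (List.suffix_of_suffix_length_le hs hl' ?_)
    rw [List.length_drop]; omega
  have hge : l'.length < t0.val * d → l'.reduceOption.length ≤ j0 := by
    intro hh
    refine suf_len (List.suffix_of_suffix_length_le hl' hs ?_)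
    rw [List.length_drop]; omega
  have hdiv : t0.val ≤ l'.length / d ↔ t0.val * d ≤ l'.length := Nat.le_div_iff_mul_le hd0
  have hv := vv_le (x t0) (y t0)
  set v := vv (x t0) (y t0) with hvdef
  -- exponent relation
  have hex : ∀ i, l'.reduceOption.length < d →
      ∃ D : ℤ, (Hx y l'.length i : ℤ) + zf (N - shf j0 v) l'.reduceOption.length i =
        Hx x l'.length i + zf N l'.reduceOption.length i + D ∧ D.natAbs ≤ 1 ∧
        (l'.reduceOption.length ≠ j0 → D = 0) := by
    intro i hjd
    refine ⟨(if t0.val ≤ l'.length / d then v i else 0) - if j0 < l'.reduceOption.length then v i else 0,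
      ?_, ?_, ?_⟩
    · rw [zf_shift hd N j0 v _ hjd i, Hx_nb x y t0 h]
      ring
    · have := hv i
      split_ifs <;> omega
    · intro hne
      by_cases hc : t0.val * d ≤ l'.length
      · have := hle hc
        rw [if_pos (hdiv.2 hc), if_pos (by omega)]; ring
      · have := hge (by omega)
        rw [if_neg (fun hcc => hc (hdiv.1 hcc)), if_neg (by omega)]; ring
  constructor
  · intro hne
    funext i
    unfold rate
    split_ifs with hc
    · rfl
    · push Not at hc
      obtain ⟨D, h1, h2, h3⟩ := hex i hc.2
      rw [h3 hne, add_zero] at h1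
      have h1' : (Hx y l'.length i : ℝ) + zf (N - shf j0 v) l'.reduceOption.length i =
        Hx x l'.length i + zf N l'.reduceOption.length i := by exact_mod_cast h1
      congr 4
      linarith
  · intro i
    unfold rate
    split_ifs with hc
    · simp
    · push Not at hc
      obtain ⟨D, h1, h2, h3⟩ := hex i hc.2
      have h1' : (Hx y l'.length i : ℝ) + zf (N - shf j0 v) l'.reduceOption.length i =
        Hx x l'.length i + zf N l'.reduceOption.length i + D := by exact_mod_cast h1
      have hD1 : (D : ℝ) ≤ 1 := by exact_mod_cast (show D ≤ 1 by omega)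
      have hD2 : (-1 : ℝ) ≤ D := by exact_mod_cast (show -1 ≤ D by omega)
      rw [← Real.toNNReal_mul (by positivity), ← Real.toNNReal_mul (by positivity)]
      constructor <;> apply Real.toNNReal_le_toNNReal <;> rw [← mul_div_assoc, ← Real.exp_add] <;>
        gcongr <;> nlinarith

noncomputable def Q {d T L : ℕ} (r : ℝ) (h0 : 0 ≤ r) (h1 : r < 1) (e : ℝ) (κ : Fin d → ℝ)
    (x : Fin T → Fin d → Bool) : PMF (Hst d) :=
  (nP (Fin L × Fin d × Fin d) r h0 h1).bind fun N => mu (rate e κ (zf N) (Hx x)) (T * d) []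

lemma Q_priv {d T L : ℕ} (hd0 : 0 < d) (hd : d ≤ 2 ^ L) (r : ℝ) (h0 : 0 < r) (h1 : r < 1)
    (e : ℝ) (he : 0 < e) (κ : Fin d → ℝ)
    (x y : Fin T → Fin d → Bool) (h : EventNeighboring x y) (l : Hst d) :
    Q (L := L) r h0.le h1 e κ x l ≤ 
      ENNReal.ofReal ((r ^ (L * d))⁻¹ * Real.exp e ^ 3) * Q (L := L) r h0.le h1 e κ y l := by
  obtain ⟨t0, h⟩ := h
  rw [Q, Q, PMF.bind_apply, PMF.bind_apply]
  simp only [mu_apply]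
  by_cases hl : l.length = T * d
  swap
  · simp [hl]
  simp only [hl, if_true]
  set v := vv (x t0) (y t0) with hv
  set j0 := (l.drop (l.length - t0.val * d)).reduceOption.length with hj0
  have key : ∀ N : Fin L × Fin d × Fin d → ℤ, W (rate e κ (zf N) (Hx x)) l ≤ (Real.toNNReal (Real.exp e)) ^ 3 *
      W (rate e κ (zf (N - shf j0 v)) (Hx y)) l := fun N => rate_priv hd0 hd e he κ x y t0 h N l
  rw [← (Equiv.subRight (shf (L := L) j0 v)).tsum_eq (fun N => nP (Fin L × Fin d × Fin d) r h0.le h1 N * 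
    (W (rate e κ (zf N) (Hx y)) l : ℝ≥0∞)), ← ENNReal.tsum_mul_left]
  refine ENNReal.tsum_le_tsum fun N => ?_
  simp only [Equiv.subRight_apply]
  have a1 := nP_shift (Fin L × Fin d × Fin d) r h0 h1 N (shf j0 v) (L * d) (shf_sum j0 v (vv_le _ _))
  have a2 : (W (rate e κ (zf N) (Hx x)) l : ℝ≥0∞) ≤ ENNReal.ofReal (Real.exp e ^ 3) * 
      (W (rate e κ (zf (N - shf j0 v)) (Hx y)) l : ℝ≥0∞) := by
    rw [ENNReal.ofReal, Real.toNNReal_pow (by positivity)]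
    exact_mod_cast key N
  rw [ENNReal.ofReal_mul (by positivity)]
  calc _ ≤ _ := mul_le_mul' a1 a2
    _ = _ := by ring

def out {d T : ℕ} (l : Hst d) (t : Fin T) (i : Fin d) : Bool :=
  decide (i ∈ (l.drop (T * d - (t.val + 1) * d)).reduceOption)

noncomputable def Mech {d T L : ℕ} (r : ℝ) (h0 : 0 ≤ r) (h1 : r < 1) (e : ℝ) (κ : Fin d → ℝ)
    (x : Fin T → Fin d → Bool) : Measure (Fin T → Fin d → Bool) :=
  ((Q (L := L) r h0 h1 e κ x).map out).toMeasure

lemma mech_dp {d T L : ℕ} (hd0 : 0 < d) (hd : d ≤ 2 ^ L) (r : ℝ) (h0 : 0 < r) (h1 : r < 1)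
    (e : ℝ) (he : 0 < e) (κ : Fin d → ℝ) (ε : ℝ) (hε : (r ^ (L * d))⁻¹ * Real.exp e ^ 3 ≤ Real.exp ε) :
    IsEventDP ε (Mech (T := T) (L := L) r h0.le h1 e κ) := by
  intro x y hxy S hS
  rw [Mech, Mech, PMF.toMeasure_apply_eq_toOuterMeasure, PMF.toMeasure_apply_eq_toOuterMeasure,
    PMF.toOuterMeasure_map_apply, PMF.toOuterMeasure_map_apply, PMF.toOuterMeasure_apply,
    PMF.toOuterMeasure_apply, ← ENNReal.tsum_mul_left]
  refine ENNReal.tsum_le_tsum fun l => ?_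
  by_cases hl : l ∈ (out (d := d) (T := T)) ⁻¹' S
  · rw [Set.indicator_of_mem hl, Set.indicator_of_mem hl]
    refine (Q_priv hd0 hd r h0 h1 e he κ x y hxy l).trans ?_
    gcongr
  · rw [Set.indicator_of_notMem hl, Set.indicator_of_notMem hl]
    simp

lemma mech_co {d T L : ℕ} (hd0 : 0 < d) (r : ℝ) (h0 : 0 ≤ r) (h1 : r < 1)
    (e : ℝ) (κ : Fin d → ℝ) : IsCOMech (Mech (T := T) (L := L) r h0 h1 e κ) := by
  refine ⟨Measurable.of_discrete, fun x => by unfold Mech; infer_instance, ?_⟩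
  intro t x y hxy
  unfold Mech
  rw [PMF.toMeasure_map _ _ Measurable.of_discrete, PMF.toMeasure_map _ _ Measurable.of_discrete,
    PMF.map_comp, PMF.map_comp]
  have hT : (t.val + 1) * d ≤ T * d := Nat.mul_le_mul_right d t.2
  have hf : ((fun (a : Fin T → Fin d → Bool) (s : {s : Fin T // s ≤ t}) => a s.1) ∘ out) =
      (fun (l : Hst d) (s : {s : Fin T // s ≤ t}) (i : Fin d) => 
        decide (i ∈ (l.drop ((t.val + 1) * d - (s.1.val + 1) * d)).reduceOption)) ∘
      (List.drop (T * d - (t.val + 1) * d)) := by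
    funext l s i
    have : (s.1.val + 1) * d ≤ (t.val + 1) * d := Nat.mul_le_mul_right d (Nat.succ_le_succ (Fin.le_def.1 s.2))
    simp only [Function.comp_apply, out, List.drop_drop]
    congr 4
    omega
  have hQ : (Q (L := L) r h0 h1 e κ x).map (List.drop (T * d - (t.val + 1) * d)) =
      (Q (L := L) r h0 h1 e κ y).map (List.drop (T * d - (t.val + 1) * d)) := by
    unfold Q
    rw [PMF.map_bind, PMF.map_bind]
    congr 1
    funext N
    have e1 : T * d = (t.val + 1) * d + (T * d - (t.val + 1) * d) := by omega
    have e2 : ∀ x : Fin T → Fin d → Bool, 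
        (mu (rate e κ (zf N) (Hx x)) (T * d) []).map (List.drop (T * d - (t.val + 1) * d)) =
        mu (rate e κ (zf N) (Hx x)) ((t.val + 1) * d) [] := by
      intro x
      conv_lhs => rw [e1]
      rw [Nat.add_sub_cancel_left]
      exact mu_tail _ _ _
    rw [e2, e2]
    refine mu_congr _ _ _ fun l hl => ?_
    have : l.length / d < t.val + 1 := (Nat.div_lt_iff_lt_mul hd0).2 hl
    funext i
    unfold rate
    rw [Hx_congr x y l.length (fun s hs => hxy s (by rw [Fin.le_def]; omega))]
  rw [hf, ← PMF.map_comp, ← PMF.map_comp, hQ]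

def SB {d : ℕ} (κ : Fin d → ℝ) (H : ℕ → Fin d → ℕ) (base : ℝ) (l : Hst d) (i : Fin d) : Prop :=
  i ∈ l.reduceOption ∨ (H l.length i : ℝ) ≤ κ i - base

section det
variable {d : ℕ} (κ : Fin d → ℝ) (H : ℕ → Fin d → ℕ) (base : ℝ) (K : ℝ≥0)

lemma bad_nodup (ρ : Hst d → Fin d → ℝ≥0) (l : Hst d) (h : ¬ Bad ρ K (SB κ H base) l) :
    l.reduceOption.Nodup := by
  induction l with
  | nil => simp
  | cons o l ih =>
    cases o with
    | none => 
      simp only [Bad, not_or] at h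
      simpa using ih h.1
    | some i =>
      simp only [Bad, SB, not_or] at h
      rw [List.reduceOption_cons_of_some, List.nodup_cons]
      exact ⟨h.2.1, ih h.1⟩

lemma bad_suffix (ρ : Hst d → Fin d → ℝ≥0) (sb) (l : Hst d) (h : ¬ Bad ρ K sb l) (m : ℕ) :
    ¬ Bad ρ K sb (l.drop m) := by
  induction l generalizing m with
  | nil => simpa using h
  | cons o l ih =>
    cases m with
    | zero => simpa using h
    | succ m =>
      rw [List.drop_succ_cons]
      apply ih
      intro hb
      apply h
      cases o
      · exact Or.inl hb
      · exact Or.inl hb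

lemma det_no (ρ : Hst d → Fin d → ℝ≥0) (i : Fin d) (n : ℕ) (hH : ∀ u < n, (H u i : ℝ) ≤ κ i - base)
    (l : Hst d) (h : ¬ Bad ρ K (SB κ H base) l) (hl : l.length ≤ n) : i ∉ l.reduceOption := by
  induction l with
  | nil => simp
  | cons o l ih =>
    simp only [List.length_cons] at hl
    cases o with
    | none => 
      simp only [Bad, not_or] at h
      simpa using ih h.1 (by omega)
    | some k =>
      simp only [Bad, SB, not_or] at h
      rw [List.reduceOption_cons_of_some, List.mem_cons, not_or]
      refine ⟨?_, ih h.1 (by omega)⟩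
      rintro rfl
      exact h.2.2 (hH _ (by omega))

lemma det_yes (ρ : Hst d → Fin d → ℝ≥0) (i : Fin d) (n : ℕ) 
    (hK : ∀ l : Hst d, n ≤ l.length → l.length < n + d → i ∉ l.reduceOption → l.reduceOption.length < d →
      K ≤ ρ l i)
    (m : ℕ) (hm : m ≤ d) (l : Hst d) (h : ¬ Bad ρ K (SB κ H base) l) (hl : l.length = n + m)
    (hi : i ∉ l.reduceOption) : m ≤ l.reduceOption.length := by
  induction m generalizing l with
  | zero => omega
  | succ m ih =>
    cases l with
    | nil => simp at hl
    | cons o l =>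
      simp only [List.length_cons] at hl
      cases o with
      | none =>
        exfalso
        simp only [Bad, not_or, Lam] at h
        rw [List.reduceOption_cons_of_none] at hi
        have hnd := bad_nodup κ H base K ρ l h.1
        have hnd' : (i :: l.reduceOption).Nodup := List.nodup_cons.2 ⟨hi, hnd⟩
        have := hnd'.length_le_card
        simp only [List.length_cons, Fintype.card_fin] at this
        apply h.2
        refine (hK l (by omega) (by omega) hi (by omega)).trans ?_
        exact le_add_of_nonneg_of_le (by positivity) 
          (Finset.single_le_sum (f := fun i => ρ l i) (fun _ _ => by positivity) (Finset.mem_univ i))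
      | some k =>
        simp only [Bad, not_or] at h
        rw [List.reduceOption_cons_of_some, List.mem_cons, not_or] at hi
        have := ih (by omega) l h.1 (by omega) hi.2
        simp only [List.reduceOption_cons_of_some, List.length_cons]
        omega

lemma det_yes' (ρ : Hst d → Fin d → ℝ≥0) (i : Fin d) (n : ℕ) 
    (hK : ∀ l : Hst d, n ≤ l.length → l.length < n + d → i ∉ l.reduceOption → l.reduceOption.length < d →
      K ≤ ρ l i)
    (l : Hst d) (h : ¬ Bad ρ K (SB κ H base) l) (hl : l.length = n + d) : i ∈ l.reduceOption := by
  by_contra hi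
  have h1 := det_yes κ H base K ρ i n hK d le_rfl l h hl hi
  have hnd' : (i :: l.reduceOption).Nodup := List.nodup_cons.2 ⟨hi, bad_nodup κ H base K ρ l h⟩
  have := hnd'.length_le_card
  simp only [List.length_cons, Fintype.card_fin] at this
  omega
end det

end DAT
namespace DAT
open scoped NNReal ENNReal

def Good {d T : ℕ} (κ : Fin d → ℝ) (α : Fin T → ℝ) (x : Fin T → Fin d → Bool) :
    Set (Fin T → Fin d → Bool) :=
  {a | ∀ (t : Fin T) (i : Fin d), (κ i + α t ≤ (hist x t i : ℝ) → a t i = true) ∧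
    ((hist x t i : ℝ) ≤ κ i - α t → a t i = false)}

lemma acc_cond {d T : ℕ} (hd0 : 0 < d) (e : ℝ) (he : 0 < e) (κ : Fin d → ℝ) (z : ℕ → Fin d → ℤ)
    (x : Fin T → Fin d → Bool) (α : Fin T → ℝ) (base B : ℝ) (K : ℝ≥0) (hK0 : 0 < K)
    (hz : ∀ j < d, ∀ i, |(z j i : ℝ)| ≤ B) (hbase : ∀ t, base ≤ α t)
    (hK : ∀ (t : Fin T) (u : ℕ), u < (t.val + 1) * d → 
      (K : ℝ) * ((u + 1) * (u + 2)) ≤ Real.exp (e * (α t - B))) :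
    (mu (rate e κ z (Hx x)) (T * d) []).toOuterMeasure (out ⁻¹' (Good κ α x)ᶜ) ≤
      ENNReal.ofReal (d / K + Real.exp (e * (B - base)) * d) := by
  set ρ := rate e κ z (Hx x) with hρ
  set c : ℝ≥0 := Real.toNNReal (Real.exp (e * (B - base))) with hc
  have hsub : (mu ρ (T * d) []).toOuterMeasure (out ⁻¹' (Good κ α x)ᶜ) ≤
      (mu ρ (T * d) []).toOuterMeasure {l | Bad ρ K (SB κ (Hx x) base) l} := by
    refine PMF.toOuterMeasure_mono _ ?_
    rintro l ⟨hl, hs⟩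
    by_contra hb
    simp only [Set.mem_ofPred_eq] at hb
    apply hl
    have hlen : l.length = T * d := by
      rw [PMF.mem_support_iff, mu_apply] at hs
      by_contra hh
      simp [hh] at hs
    intro t i
    have hT : (t.val + 1) * d ≤ T * d := Nat.mul_le_mul_right d t.2
    have hb' := bad_suffix K ρ _ l hb (T * d - (t.val + 1) * d)
    have hlen' : (l.drop (T * d - (t.val + 1) * d)).length = t.val * d + d := by
      rw [List.length_drop, hlen, ← Nat.succ_mul]; simp only [Nat.succ_eq_add_one]; omega
    constructor
    · intro hh
      simp only [out, decide_eq_true_eq]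
      refine det_yes' κ (Hx x) base K ρ i (t.val * d) ?_ _ hb' hlen'
      intro l' h1 h2 h3 h4
      have hu : l'.length / d = t.val := by
        rw [Nat.div_eq_iff hd0]
        constructor
        · omega
        · omega
      have hk := hK t l'.length (by rw [Nat.add_mul]; omega)
      rw [hρ, rate, if_neg (by push Not; exact ⟨h3, h4⟩)]
      rw [← NNReal.coe_le_coe, Real.coe_toNNReal _ (by positivity), le_div_iff₀ (by positivity)]
      refine hk.trans (Real.exp_le_exp.2 ?_)
      rw [Hx_eq x _ t hu]
      have := (abs_le.1 (hz _ h4 i)).1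
      refine mul_le_mul_of_nonneg_left ?_ he.le
      linarith
    · intro hh
      simp only [out, decide_eq_false_iff_not]
      refine det_no κ (Hx x) base K ρ i ((t.val + 1) * d) ?_ _ hb' (by rw [hlen', Nat.add_mul]; omega)
      intro u hu
      have h1 : u / d < t.val + 1 := (Nat.div_lt_iff_lt_mul hd0).2 hu
      have h2 : (Hx x u i : ℝ) ≤ hist x t i := by exact_mod_cast Hx_le x u t (by omega) i
      have := hbase t
      linarith
  refine hsub.trans ?_
  classical
  have hb := bad_bound ρ K c hK0 (SB κ (Hx x) base) ?_ ?_ (T * d) []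
  · refine hb.trans (le_of_eq ?_)
    rw [if_neg (by simp [Bad])]
    rw [ENNReal.ofReal]
    congr 1
    rw [← NNReal.coe_inj, Real.coe_toNNReal _ (by positivity)]
    simp only [Fp, Lam, hc]
    simp
    exact Or.inl (Real.exp_pos _).le
  · intro l i hne
    rw [hρ, rate] at hne
    by_contra hh
    simp [not_lt.1 hh] at hne
  · intro l i hsb
    rw [hρ, rate]
    split_ifs with h
    · positivity
    · push Not at h
      have h2 : (Hx x l.length i : ℝ) ≤ κ i - base := hsb.resolve_left h.1
      rw [← NNReal.coe_le_coe, Real.coe_toNNReal _ (by positivity)]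
      push_cast
      rw [hc, Real.coe_toNNReal _ (by positivity)]
      have := (abs_le.1 (hz _ h.2 i)).2
      gcongr
      linarith

lemma acc {d T L : ℕ} (hd0 : 0 < d) (s : ℝ) (h0 : 0 < s) (h1 : s < 1) (hr0 : 0 ≤ s ^ 2) (hr : s ^ 2 < 1)
    (e : ℝ) (he : 0 < e) (κ : Fin d → ℝ) 
    (x : Fin T → Fin d → Bool) (α : Fin T → ℝ) (base B δ : ℝ) (hδ : 0 < δ) (K : ℝ≥0) (hK0 : 0 < K)
    (hB : ∀ n : ℕ, B < n → δ⁻¹ ≤ (s ^ n)⁻¹) (hbase : ∀ t, base ≤ α t)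
    (hK : ∀ (t : Fin T) (u : ℕ), u < (t.val + 1) * d → 
      (K : ℝ) * ((u + 1) * (u + 2)) ≤ Real.exp (e * (α t - B))) (β : ℝ) (hβ1 : β ≤ 1)
    (hβ : (d : ℝ) * d * (2 ^ L * δ) + (d / K + Real.exp (e * (B - base)) * d) ≤ β) :
    ENNReal.ofReal (1 - β) ≤ Mech (L := L) (s ^ 2) hr0 hr e κ x (Good κ α x) := by
  have hpos : 0 ≤ (d / K + Real.exp (e * (B - base)) * d : ℝ) := by positivity
  have hbad : Mech (L := L) (s ^ 2) hr0 hr e κ x (Good κ α x)ᶜ ≤ ENNReal.ofReal β := by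
    rw [Mech, PMF.toMeasure_apply_eq_toOuterMeasure, PMF.toOuterMeasure_map_apply, Q,
      PMF.toOuterMeasure_bind_apply]
    set E : Set (Fin L × Fin d × Fin d → ℤ) := 
      ⋃ j : Fin d, ⋃ i : Fin d, {N | δ⁻¹ ≤ (s ^ (∑ n ∈ nodes L j i, (N n).natAbs))⁻¹} with hE
    have hEm : (nP (Fin L × Fin d × Fin d) (s ^ 2) hr0 hr).toOuterMeasure E ≤ 
        ENNReal.ofReal ((d : ℝ) * d * (2 ^ L * δ)) := by
      calc _ ≤ ∑ j : Fin d, ∑ i : Fin d, ENNReal.ofReal (2 ^ L * δ) := by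
            refine (measure_iUnion_fintype_le _ _).trans (Finset.sum_le_sum fun j _ => ?_)
            refine (measure_iUnion_fintype_le _ _).trans (Finset.sum_le_sum fun i _ => ?_)
            exact nP_tail _ s h0 h1 hr0 hr (nodes L j i) L (nodes_card L j i) δ hδ
        _ = _ := by
            simp only [Finset.sum_const, Finset.card_univ, Fintype.card_fin, nsmul_eq_mul]
            rw [ENNReal.ofReal_mul (by positivity), ENNReal.ofReal_mul (by positivity)]
            simp [mul_assoc]
    calc _ ≤ ∑' N, (E.indicator (nP (Fin L × Fin d × Fin d) (s ^ 2) hr0 hr) N + 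
            nP (Fin L × Fin d × Fin d) (s ^ 2) hr0 hr N * 
              ENNReal.ofReal (d / K + Real.exp (e * (B - base)) * d)) := by
          refine ENNReal.tsum_le_tsum fun N => ?_
          by_cases hN : N ∈ E
          · rw [Set.indicator_of_mem hN]
            refine le_add_of_le_of_nonneg ?_ (by positivity)
            refine mul_le_of_le_one_right (by positivity) ?_
            rw [← PMF.tsum_coe (mu (rate e κ (zf N) (Hx x)) (T * d) []), PMF.toOuterMeasure_apply]
            exact ENNReal.tsum_le_tsum fun l => Set.indicator_le_self _ _ l
          · refine le_add_of_nonneg_of_le (by positivity) ?_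
            gcongr
            refine acc_cond hd0 e he κ (zf N) x α base B K hK0 ?_ hbase hK
            intro j hj i
            by_contra hlt
            push Not at hlt
            apply hN
            simp only [hE, Set.mem_iUnion, Set.mem_ofPred_eq]
            refine ⟨⟨j, hj⟩, i, hB _ ?_⟩
            refine hlt.trans_le ?_
            rw [← Int.cast_abs, ← Nat.cast_natAbs]
            exact_mod_cast zf_le N j i
      _ = (nP (Fin L × Fin d × Fin d) (s ^ 2) hr0 hr).toOuterMeasure E + 
            ENNReal.ofReal (d / K + Real.exp (e * (B - base)) * d) := by
          rw [ENNReal.tsum_add, ENNReal.tsum_mul_right, PMF.tsum_coe, one_mul, PMF.toOuterMeasure_apply]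
      _ ≤ _ := by
          refine (add_le_add_left hEm _).trans ?_
          rw [← ENNReal.ofReal_add (by positivity) hpos]
          exact ENNReal.ofReal_le_ofReal hβ
  have hprob : IsProbabilityMeasure (Mech (L := L) (s ^ 2) hr0 hr e κ x) := by
    unfold Mech; infer_instance
  have hGm : MeasurableSet (Good κ α x) := MeasurableSet.of_discrete
  have hadd := prob_add_prob_compl (μ := Mech (L := L) (s ^ 2) hr0 hr e κ x) hGm
  have hβ0 : 0 ≤ β := le_trans (by positivity) hβ
  rw [ENNReal.ofReal_sub _ hβ0, ENNReal.ofReal_one, tsub_le_iff_right, ← hadd]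
  gcongr

lemma exp_log2c (z : ℝ) : max z 2 ≤ Real.exp (log2c z) := by
  have h2 : (0:ℝ) < max z 2 := lt_of_lt_of_le two_pos (le_max_right _ _)
  calc max z 2 = (2:ℝ) ^ (log2c z) := by
        rw [log2c, Real.rpow_logb two_pos (by norm_num) h2]
    _ = Real.exp (Real.log 2 * log2c z) := by rw [Real.rpow_def_of_pos two_pos]
    _ ≤ _ := by
        apply Real.exp_le_exp.2
        have h3 : 0 ≤ log2c z := Real.logb_nonneg (by norm_num) (le_trans (by norm_num) (le_max_right _ _))
        have := Real.log_two_lt_d9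
        nlinarith

lemma one_le_log2c (z : ℝ) : 1 ≤ log2c z := by
  rw [log2c, Real.le_logb_iff_rpow_le (by norm_num) (lt_of_lt_of_le two_pos (le_max_right _ _))]
  simp

lemma natlog_le (d : ℕ) (hd : 1 ≤ d) (β : ℝ) (h0 : 0 < β) (h1 : β < 1) : 
    ((Nat.log 2 d + 1 : ℕ) : ℝ) ≤ 2 * log2c (d / β) := by
  have h : (Nat.log 2 d : ℝ) ≤ log2c (d / β) := by
    rw [log2c, Real.le_logb_iff_rpow_le (by norm_num) (lt_of_lt_of_le two_pos (le_max_right _ _)),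
      Real.rpow_natCast]
    refine le_trans ?_ (le_max_left _ _)
    have : ((2 ^ Nat.log 2 d : ℕ) : ℝ) ≤ d := by exact_mod_cast Nat.pow_log_le_self 2 (by omega)
    push_cast at this
    refine this.trans ?_
    rw [le_div_iff₀ h0]
    have : (0:ℝ) ≤ d := by positivity
    nlinarith
  have := one_le_log2c (d / β)
  push_cast
  linarith

lemma numK (d β τ A E u : ℝ) (hu0 : 0 ≤ u) (hd1 : 1 ≤ d) (hβ0 : 0 < β) (hτ0 : 1 ≤ τ) (hA1 : d / β ≤ A)
    (hA2 : 2 ≤ A) (hdA : d ≤ A) (hτE : τ ≤ E) (hu' : u + 1 ≤ τ * d) :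
    4 * d / β * ((u + 1) * (u + 2)) ≤ A ^ 6 * E ^ 2 := by
  have h8 : (8:ℝ) ≤ A ^ 3 := by
    calc (8:ℝ) = 2 ^ 3 := by norm_num
      _ ≤ _ := by gcongr
  have hτd : 1 ≤ τ * d := one_le_mul_of_one_le_of_one_le hτ0 hd1
  have hA0 : 0 < A := by linarith
  calc 4 * d / β * ((u + 1) * (u + 2)) ≤ 4 * d / β * ((τ * d) * (2 * (τ * d))) := by
        refine mul_le_mul_of_nonneg_left ?_ (by positivity)
        exact mul_le_mul hu' (by linarith) (by positivity) (by positivity)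
    _ = 8 * ((d / β) * d ^ 2) * τ ^ 2 := by ring
    _ ≤ A ^ 3 * (A * A ^ 2) * E ^ 2 := by gcongr
    _ = _ := by ring

end DAT

set_option maxHeartbeats 1000000 in
theorem d_dim_above_threshold_upper :
    ∃ C : ℝ, 0 < C ∧
      ∀ (ε β : ℝ) (d T : ℕ) (κ : Fin d → ℝ),
        0 < ε → β ∈ Set.Ioo (0 : ℝ) 1 → 1 ≤ d → 1 ≤ T →
        ∃ M : (Fin T → Fin d → Bool) → Measure (Fin T → Fin d → Bool),
          IsCOMech M ∧ IsEventDP ε M ∧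
          ∀ x, ENNReal.ofReal (1 - β) ≤
            M x {a | ∀ (t : Fin T) (i : Fin d),
              (κ i + C * ε⁻¹ * ((d : ℝ) * (log2c ((d : ℝ) / β)) ^ 2
                    + log2c (((t : ℕ) + 1 : ℝ) / β)) ≤ (hist x t i : ℝ) →
                a t i = true) ∧
              ((hist x t i : ℝ) ≤ κ i - C * ε⁻¹ * ((d : ℝ) * (log2c ((d : ℝ) / β)) ^ 2
                    + log2c (((t : ℕ) + 1 : ℝ) / β)) →
                a t i = false)} := by
  refine ⟨100, by norm_num, ?_⟩
  intro ε β d T κ hε hβ hd hT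
  obtain ⟨hβ0, hβ1⟩ := hβ
  have hd1 : (1:ℝ) ≤ d := by exact_mod_cast hd
  have hℓ1 := DAT.one_le_log2c (d / β)
  have hEℓ := DAT.exp_log2c (d / β)
  have hLℓ := DAT.natlog_le d hd β hβ0 hβ1
  have hL2 : d < 2 ^ (Nat.log 2 d + 1) := Nat.lt_pow_succ_log_self (by norm_num) d
  have hL3 : (2:ℝ) ^ (Nat.log 2 d + 1) ≤ 2 * d := by
    have : ((2 ^ Nat.log 2 d : ℕ) : ℝ) ≤ d := by exact_mod_cast Nat.pow_log_le_self 2 (by omega)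
    push_cast at this
    rw [pow_succ]; linarith
  have hL0 : 0 < Nat.log 2 d + 1 := Nat.succ_pos _
  set L := Nat.log 2 d + 1 with hL
  set ℓ := log2c (d / β) with hℓ
  have hLr : (0:ℝ) < L := by exact_mod_cast hL0
  have hdpos : (0:ℝ) < d := by linarith
  set η : ℝ := ε / (2 * L * d) with hη
  have hηpos : 0 < η := by positivity
  set s := Real.exp (-(η / 2)) with hs
  have hs0 : 0 < s := Real.exp_pos _
  have hs1 : s < 1 := by rw [hs, Real.exp_lt_one_iff]; linarith
  have hr0 : 0 ≤ s ^ 2 := by positivity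
  have hr0' : 0 < s ^ 2 := by positivity
  have hr : s ^ 2 < 1 := by nlinarith
  set A := Real.exp ℓ with hA
  have hA1 : d / β ≤ A := (le_max_left _ _).trans hEℓ
  have hA2 : 2 ≤ A := (le_max_right _ _).trans hEℓ
  have hdβ : (d:ℝ) ≤ d / β := by
    rw [le_div_iff₀ hβ0]; nlinarith
  have hA0 : 0 < A := by linarith
  set B : ℝ := 20 * L * d * ℓ / ε with hB
  set base : ℝ := B + 18 * ℓ / ε with hbase
  have hBle : B ≤ 40 * (d * ℓ ^ 2) * ε⁻¹ := by
    rw [hB, div_eq_mul_inv]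
    refine mul_le_mul_of_nonneg_right ?_ (by positivity)
    have : 0 ≤ (d:ℝ) * ℓ := by positivity
    nlinarith
  have hℓd : ℓ ≤ d * ℓ ^ 2 := by nlinarith
  have hεi : 0 < ε⁻¹ := by positivity
  set K : NNReal := Real.toNNReal (4 * d / β) with hK
  have hKr : (K : ℝ) = 4 * d / β := by rw [hK, Real.coe_toNNReal _ (by positivity)]
  have hK0 : 0 < K := by rw [hK, Real.toNNReal_pos]; positivity
  refine ⟨DAT.Mech (L := L) (s ^ 2) hr0 hr (ε / 6) κ, DAT.mech_co hd _ _ _ _ _, ?_, ?_⟩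
  · refine DAT.mech_dp hd hL2.le (s ^ 2) hr0' hr (ε / 6) (by positivity) κ ε (le_of_eq ?_)
    rw [hs, ← Real.exp_nat_mul, ← Real.exp_nat_mul, ← Real.exp_nat_mul, ← Real.exp_neg, ← Real.exp_add]
    congr 1
    rw [hη]
    push_cast
    field_simp
    ring
  · intro x
    refine DAT.acc (L := L) hd s hs0 hs1 hr0 hr (ε / 6) (by positivity) κ x
      (fun t => 100 * ε⁻¹ * ((d : ℝ) * ℓ ^ 2 + log2c (((t : ℕ) + 1 : ℝ) / β)))
      base B (Real.exp (-(5 * ℓ))) (Real.exp_pos _) K hK0 ?_ ?_ ?_ β hβ1.le ?_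
    · intro n hn
      rw [hs, ← Real.exp_nat_mul, ← Real.exp_neg, ← Real.exp_neg]
      apply Real.exp_le_exp.2
      have : 5 * ℓ = B * (η / 2) := by
        rw [hB, hη]; field_simp; ring
      rw [neg_neg, this]
      nlinarith
    · intro t
      have h1 := DAT.one_le_log2c (((t : ℕ) + 1 : ℝ) / β)
      have : base ≤ 40 * (d * ℓ ^ 2) * ε⁻¹ + 18 * (d * ℓ ^ 2) * ε⁻¹ := by
        rw [hbase, div_eq_mul_inv]
        gcongr
      have h3 : 0 ≤ ε⁻¹ * log2c (((t : ℕ) + 1 : ℝ) / β) := by positivity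
      have h4 : 0 ≤ ε⁻¹ * (d * ℓ ^ 2) := by positivity
      show base ≤ 100 * ε⁻¹ * ((d : ℝ) * ℓ ^ 2 + log2c (((t : ℕ) + 1 : ℝ) / β))
      nlinarith
    · intro t u hu
      have h1 := DAT.one_le_log2c (((t : ℕ) + 1 : ℝ) / β)
      have h2 := (le_max_left _ _).trans (DAT.exp_log2c (((t : ℕ) + 1 : ℝ) / β))
      set ℓt := log2c (((t : ℕ) + 1 : ℝ) / β) with hℓt
      set τ : ℝ := (t : ℕ) + 1 with hτ
      have hτ0 : 1 ≤ τ := by rw [hτ]; have : (0:ℝ) ≤ (t:ℕ) := by positivity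
                             linarith
      have hu' : (u : ℝ) + 1 ≤ τ * d := by
        rw [hτ]; exact_mod_cast hu
      have hexp : 6 * ℓ + 2 * ℓt ≤ ε / 6 * (100 * ε⁻¹ * ((d : ℝ) * ℓ ^ 2 + ℓt) - B) := by
        have a1 : ε / 6 * (100 * ε⁻¹ * ((d : ℝ) * ℓ ^ 2 + ℓt) - 40 * (d * ℓ ^ 2) * ε⁻¹) ≤
            ε / 6 * (100 * ε⁻¹ * ((d : ℝ) * ℓ ^ 2 + ℓt) - B) := by gcongr
        have a2 : ε / 6 * (100 * ε⁻¹ * ((d : ℝ) * ℓ ^ 2 + ℓt) - 40 * (d * ℓ ^ 2) * ε⁻¹) =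
            10 * (d * ℓ ^ 2) + 100 / 6 * ℓt := by field_simp; ring
        linarith
      refine le_trans ?_ (Real.exp_le_exp.2 hexp)
      rw [hKr, Real.exp_add, show 6 * ℓ = ((6:ℕ):ℝ) * ℓ by norm_num, 
        show 2 * ℓt = ((2:ℕ):ℝ) * ℓt by norm_num, Real.exp_nat_mul, Real.exp_nat_mul]
      have hτβ : τ ≤ Real.exp ℓt := by
        refine le_trans ?_ h2
        rw [le_div_iff₀ hβ0]; exact mul_le_of_le_one_right (by linarith) hβ1.le
      have := DAT.numK d β τ A (Real.exp ℓt) u (Nat.cast_nonneg u) hd1 hβ0 hτ0 hA1 hA2 (hdβ.trans hA1) hτβ hu'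
      exact this
    · have e1 : Real.exp (-(5 * ℓ)) = (A ^ 5)⁻¹ := by
        rw [Real.exp_neg, show 5 * ℓ = ((5:ℕ):ℝ) * ℓ by norm_num, Real.exp_nat_mul]
      have e2 : Real.exp (ε / 6 * (B - base)) = (A ^ 3)⁻¹ := by
        rw [show ε / 6 * (B - base) = -(((3:ℕ):ℝ) * ℓ) by rw [hbase]; push_cast; field_simp; ring,
          Real.exp_neg, Real.exp_nat_mul]
      rw [e1, e2, hKr]
      have hdA : (d:ℝ) ≤ A := by linarith
      have hdA' : (d:ℝ) ≤ β * A := by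
        rw [div_le_iff₀ hβ0] at hA1; linarith
      have b1 : (d:ℝ) * d * (2 ^ L * (A ^ 5)⁻¹) ≤ β / 2 := by
        rw [← mul_assoc, ← div_eq_mul_inv, div_le_iff₀ (by positivity)]
        calc (d:ℝ) * d * 2 ^ L ≤ A * A * (2 * (β * A)) := by
              gcongr
              linarith
          _ = β / 2 * (A ^ 3 * 2 ^ 2) := by ring
          _ ≤ β / 2 * (A ^ 3 * A ^ 2) := by gcongr
          _ = _ := by ring
      have b2 : (d:ℝ) / (4 * d / β) = β / 4 := by field_simp
      have b3 : (A ^ 3)⁻¹ * d ≤ β / 4 := by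
        rw [← div_eq_inv_mul, div_le_iff₀ (by positivity)]
        calc (d:ℝ) ≤ β * A := hdA'
          _ = β / 4 * (A * 2 ^ 2) := by ring
          _ ≤ β / 4 * (A * A ^ 2) := by gcongr
          _ = _ := by ring
      linarith
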